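/- Let V be a vector space over a division ring, L = Lt(V), ā a 4-frame of L, ε : a₁ → a₂ the unique linear isomorphism with a_{12} = {v − ε(v) : v ∈ a₁}, and Γ(f) = {v − ε(f(v)) : v ∈ a₁} for f ∈ GL(a₁). Let f₁,…,f_k ∈ GL(a₁) and g_i = Γ(f_i). Then the subgroup of GL(a₁) generated by f₁,…,f_k acts fixed point freely on a₁ (i.e., the only v ∈ a₁ with f_i(v) = v for all i = 1,…,k is v = 0) if and only if a_{12} ∩ g₁ ∩ … ∩ g_k = {0}. -/

import Mathlib

variable {L : Type*} [Lattice L] {n : ℕ}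

/-- The join `∑_{i ∈ I} a i`, where the empty join is `bot`. -/
def frameSum (bot : L) (a : Fin n → L) (I : Finset (Fin n)) : L :=
  I.fold (· ⊔ ·) bot a

/-- An `n`-frame in a lattice `L`: elements `a i` (`i < n`), `e i j = a_{ij}`,
with bottom `bot = a_⊥` and top `top = a_⊤`.  An `n`-frame *of* a bounded
lattice is an `n`-frame with `bot = ⊥` and `top = ⊤`. -/
structure IsFrame (bot top : L) (a : Fin n → L) (e : Fin n → Fin n → L) : Prop where
  symm : ∀ i j : Fin n, e i j = e j i
  inf_sum : ∀ I J : Finset (Fin n),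
    frameSum bot a I ⊓ frameSum bot a J = frameSum bot a (I ∩ J)
  top_def : top = frameSum bot a Finset.univ
  sup_e : ∀ i j : Fin n, i ≠ j → a i ⊔ a j = a i ⊔ e i j
  inf_e : ∀ i j : Fin n, i ≠ j → a i ⊓ e i j = bot
  trans_e : ∀ i j k : Fin n, i ≠ j → j ≠ k → i ≠ k →
    e i k = (a i ⊔ a k) ⊓ (e i j ⊔ e j k)

variable {F V : Type*} [DivisionRing F] [AddCommGroup V] [Module F V]

/-- `Γ(f) = {v - ε(f(v)) : v ∈ a₁}`, as a subspace of `V`. -/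
def Gamma {a1 a2 : Submodule F V} (ε : a1 ≃ₗ[F] a2) (f : a1 ≃ₗ[F] a1) :
    Submodule F V :=
  LinearMap.range (a1.subtype - a2.subtype ∘ₗ ε.toLinearMap ∘ₗ f.toLinearMap)

/-- If `a1` and `a2` are disjoint, a vector `v - ε v` of the graph of `ε` lies in `Γ(f)` exactly
when `f` fixes `v`. -/
theorem sub_mem_Gamma_iff {a1 a2 : Submodule F V} (h : Disjoint a1 a2) (ε : a1 ≃ₗ[F] a2)
    (f : a1 ≃ₗ[F] a1) (v : a1) : (v : V) - (ε v : V) ∈ Gamma ε f ↔ f v = v := by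
  constructor
  · rintro ⟨u, hu⟩
    have hu' : (u : V) - (ε (f u) : V) = (v : V) - (ε v : V) := hu
    have hdiff : ((u - v : a1) : V) = ((ε (f u) - ε v : a2) : V) := by
      push_cast
      exact sub_eq_sub_iff_sub_eq_sub.mp hu'
    have hzero : ((u - v : a1) : V) = 0 :=
      Submodule.disjoint_def.mp h _ (u - v).2 (hdiff ▸ (ε (f u) - ε v).2)
    have huv : u = v := sub_eq_zero.mp (Subtype.ext hzero)
    have hεf : ε (f u) = ε v := sub_eq_zero.mp (Subtype.ext (hdiff ▸ hzero))
    exact (congrArg f huv).symm.trans (ε.injective hεf)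
  · intro hv
    exact ⟨v, by simp [hv]⟩

/-- Distinct members of a frame of the subspace lattice are disjoint. -/
theorem IsFrame.disjoint {a : Fin n → Submodule F V} {e : Fin n → Fin n → Submodule F V}
    {top : Submodule F V} (hf : IsFrame ⊥ top a e) {i j : Fin n} (hij : i ≠ j) :
    Disjoint (a i) (a j) := by
  have h := hf.inf_sum {i} {j}
  rw [Finset.singleton_inter_of_notMem (by simpa using hij)] at h
  simpa [frameSum, disjoint_iff] using h

/-- Let `ā` be a 4-frame of the subspace lattice of `V`,
`ε : a₁ ≃ a₂` the unique isomorphism with `a₁₂ = {v - ε v : v ∈ a₁}`, and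
`g i = Γ(f i)` for `f₁, …, f_k ∈ GL(a₁)`.  The subgroup generated by the `f i`
acts fixed point freely on `a₁` (the only `v` fixed by all `f i` is `0`) iff
`a₁₂ ∩ g₁ ∩ … ∩ g_k = {0}`. -/
theorem frame_fixedPointFree_iff
    (a : Fin 4 → Submodule F V) (e : Fin 4 → Fin 4 → Submodule F V)
    (hf : IsFrame (⊥ : Submodule F V) ⊤ a e)
    (ε : (a 0) ≃ₗ[F] (a 1))
    (hε : ∀ w : V, w ∈ e 0 1 ↔ ∃ v : a 0, w = (v : V) - (ε v : V))
    (k : ℕ) (f : Fin k → ((a 0) ≃ₗ[F] (a 0))) :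
    (∀ v : a 0, (∀ i : Fin k, f i v = v) → v = 0) ↔
      e 0 1 ⊓ (Finset.univ.inf fun i : Fin k => Gamma ε (f i)) = ⊥ := by
  have hdisj : Disjoint (a 0) (a 1) := hf.disjoint (by decide)
  rw [Submodule.eq_bot_iff]
  constructor
  · intro h w hw
    obtain ⟨hw₁, hw₂⟩ := Submodule.mem_inf.mp hw
    obtain ⟨v, rfl⟩ := (hε w).mp hw₁
    rw [Submodule.mem_finsetInf] at hw₂
    have hv : v = 0 := h v fun i =>
      (sub_mem_Gamma_iff hdisj ε (f i) v).mp (hw₂ i (Finset.mem_univ i))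
    simp [hv]
  · intro h v hv
    have hw : (v : V) - (ε v : V) = 0 := by
      refine h _ (Submodule.mem_inf.mpr ⟨(hε _).mpr ⟨v, rfl⟩, ?_⟩)
      rw [Submodule.mem_finsetInf]
      exact fun i _ => (sub_mem_Gamma_iff hdisj ε (f i) v).mpr (hv i)
    exact Subtype.ext (Submodule.disjoint_def.mp hdisj _ v.2 (sub_eq_zero.mp hw ▸ (ε v).2))
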